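/- arXiv:1211.6066 — 2 statements merged into one kernel-verified Lean document; each statement's English description precedes it below -/
import Mathlib

section
/- Let n ≥ 1 and p₁, p₂, p₃ ≥ 1 be integers. Then ((n−1)!)² · Σ_{a₁,a₂,a₃ ≥ 0} (p₂p₃ − a₃(p₃ − a₁)) · M(n; a₁, a₂, a₃, p₁−1−a₂−a₃, p₂−a₃−a₁, p₃−a₁−a₂, n+1+a₁+a₂+a₃−p₁−p₂−p₃) = (n!)² · Σ_{a₁,a₂,a₃ ≥ 0} M(n−1; a₁, a₂, a₃, p₁−1−a₂−a₃, p₂−1−a₃−a₁, p₃−1−a₁−a₂, n+2+a₁+a₂+a₃−p₁−p₂−p₃), where both sums range over all triples of non-negative integers a₁, a₂, a₃ (only finitely many terms are nonzero). -/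
open Finset

/-- The extended multinomial coefficient `M(N; b₁,…,b₇)`: equal to `N!/(b₁!⋯b₇!)` if all the
`b j` are non-negative and sum to `N`, and to `0` otherwise. -/
def extM (N : ℕ) (b : Fin 7 → ℤ) : ℤ :=
  if (∀ j, 0 ≤ b j) ∧ (∑ j, b j) = (N : ℤ) then
    (Nat.multinomial Finset.univ (fun j => (b j).toNat) : ℤ)
  else 0

/-- The reciprocal factorial `1 / k!`, extended by `0` to negative integers. -/
def invFactorial (k : ℤ) : ℚ :=
  if 0 ≤ k then ((k.toNat.factorial : ℚ))⁻¹ else 0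

theorem invFactorial_of_neg {k : ℤ} (hk : k < 0) : invFactorial k = 0 :=
  if_neg (not_le.mpr hk)

theorem mul_invFactorial (k : ℤ) : (k : ℚ) * invFactorial k = invFactorial (k - 1) := by
  rcases lt_trichotomy k 0 with hk | rfl | hk
  · rw [invFactorial_of_neg hk, invFactorial_of_neg (by lia), mul_zero]
  · rw [invFactorial_of_neg (by lia : (0 : ℤ) - 1 < 0), Int.cast_zero, zero_mul]
  · obtain ⟨m, rfl⟩ : ∃ m : ℕ, k = m + 1 := ⟨(k - 1).toNat, by lia⟩
    have h₁ : ((m : ℤ) + 1).toNat = m + 1 := by lia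
    have h₂ : ((m : ℤ) + 1 - 1).toNat = m := by lia
    rw [invFactorial, invFactorial, if_pos (by lia), if_pos (by lia), h₁, h₂,
      Nat.factorial_succ]
    have := Nat.factorial_ne_zero m
    push_cast
    field_simp

theorem extM_eq_factorial_mul_prod {N : ℕ} {b : Fin 7 → ℤ} (hb : ∑ j, b j = N) :
    (extM N b : ℚ) = N.factorial * ∏ j, invFactorial (b j) := by
  by_cases h : ∀ j, 0 ≤ b j
  · have hN : ∑ j, (b j).toNat = N := by
      zify
      rw [← hb]
      exact Finset.sum_congr rfl fun j _ => Int.toNat_of_nonneg (h j)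
    have hspec := Nat.multinomial_spec Finset.univ fun j => (b j).toNat
    rw [hN] at hspec
    have hprod : ∏ j, invFactorial (b j) = (∏ j, ((b j).toNat.factorial : ℚ))⁻¹ := by
      rw [← Finset.prod_inv_distrib]
      exact Finset.prod_congr rfl fun j _ => if_pos (h j)
    have hne : (∏ j, ((b j).toNat.factorial : ℚ)) ≠ 0 :=
      Finset.prod_ne_zero_iff.mpr fun j _ => Nat.cast_ne_zero.mpr (Nat.factorial_ne_zero _)
    rw [extM, if_pos ⟨h, hb⟩, hprod, ← hspec]
    push_cast
    field_simp
  · rw [extM, if_neg fun h' => h h'.1]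
    push Not at h
    obtain ⟨j, hj⟩ := h
    rw [Finset.prod_eq_zero (Finset.mem_univ j) (invFactorial_of_neg hj)]
    simp

theorem nonneg_of_extM_ne_zero {N : ℕ} {b : Fin 7 → ℤ} (h : extM N b ≠ 0) (j : Fin 7) :
    0 ≤ b j := by
  by_contra hj
  exact h (if_neg fun h' => hj (h'.1 j))

theorem finsum_eq_sum_range {M : Type*} [AddCommMonoid M] {f : ℕ → M} {B : ℕ}
    (hf : ∀ a, B ≤ a → f a = 0) : ∑ᶠ a, f a = ∑ a ∈ range B, f a := by
  refine finsum_eq_sum_of_support_subset f fun a ha => ?_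
  rw [Finset.coe_range, Set.mem_Iio]
  by_contra h
  exact ha (hf a (not_lt.mp h))

theorem finsum_triple_eq_sum_range {M : Type*} [AddCommMonoid M] {F : ℕ → ℕ → ℕ → M} {B : ℕ}
    (hF : ∀ a b c, F a b c ≠ 0 → a < B ∧ b < B ∧ c < B) :
    ∑ᶠ (a : ℕ), ∑ᶠ (b : ℕ), ∑ᶠ (c : ℕ), F a b c =
      ∑ a ∈ range B, ∑ b ∈ range B, ∑ c ∈ range B, F a b c := by
  have hzero : ∀ a b c, B ≤ a ∨ B ≤ b ∨ B ≤ c → F a b c = 0 := fun a b c h => by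
    by_contra hne
    have := hF a b c hne
    lia
  have h₃ : ∀ a b, ∑ᶠ (c : ℕ), F a b c = ∑ c ∈ range B, F a b c := fun a b =>
    finsum_eq_sum_range fun c hc => hzero a b c (.inr (.inr hc))
  have h₂ : ∀ a, ∑ᶠ (b : ℕ), ∑ᶠ (c : ℕ), F a b c =
      ∑ b ∈ range B, ∑ c ∈ range B, F a b c := fun a => by
    simp only [h₃]
    exact finsum_eq_sum_range fun b hb =>
      Finset.sum_eq_zero fun c _ => hzero a b c (.inr (.inl hb))
  simp only [h₂]
  exact finsum_eq_sum_range fun a ha => Finset.sum_eq_zero fun b _ =>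
    Finset.sum_eq_zero fun c _ => hzero a b c (.inl ha)

theorem sum_range_eq_sum_range_add_one {M : Type*} [AddCommMonoid M] {f : ℕ → M} {B : ℕ}
    (h₀ : f 0 = 0) (hB : f B = 0) : ∑ a ∈ range B, f a = ∑ a ∈ range B, f (a + 1) := by
  have h := Finset.sum_range_succ f B
  rw [Finset.sum_range_succ', h₀, hB, add_zero, add_zero] at h
  exact h.symm

/-- The product of the reciprocal factorials of `a₁, a₂, a₃` and of the four integers that
complete them to a multinomial coefficient whose marginals are `q₁, q₂, q₃` and whose last entry
is `c + a₁ + a₂ + a₃`. -/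
def invFactorialProd (q₁ q₂ q₃ c a₁ a₂ a₃ : ℤ) : ℚ :=
  invFactorial a₁ * invFactorial a₂ * invFactorial a₃ * invFactorial (q₁ - a₂ - a₃) *
    invFactorial (q₂ - a₃ - a₁) * invFactorial (q₃ - a₁ - a₂) *
    invFactorial (c + a₁ + a₂ + a₃)

theorem invFactorialProd_eq_zero {q₁ q₂ q₃ c a₁ a₂ a₃ : ℤ}
    (h : a₁ < 0 ∨ a₂ < 0 ∨ q₃ - a₁ - a₂ < 0) :
    invFactorialProd q₁ q₂ q₃ c a₁ a₂ a₃ = 0 := by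
  rcases h with h | h | h <;> simp [invFactorialProd, invFactorial_of_neg h]

theorem weight_mul_invFactorialProd (n q₁ q₂ q₃ a₁ a₂ a₃ : ℤ) :
    ((q₂ * q₃ - a₃ * (q₃ - a₁) : ℤ) : ℚ) *
        invFactorialProd q₁ q₂ q₃ (n - q₁ - q₂ - q₃) a₁ a₂ a₃ =
      n * invFactorialProd q₁ (q₂ - 1) (q₃ - 1) (n - q₁ - q₂ - q₃ + 1) (a₁ - 1) a₂ a₃ -
      invFactorialProd (q₁ - 1) (q₂ - 1) (q₃ - 1) (n - q₁ - q₂ - q₃ + 1) (a₁ - 1) a₂ a₃ -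
      invFactorialProd q₁ (q₂ - 1) (q₃ - 1) (n - q₁ - q₂ - q₃) (a₁ - 1) a₂ a₃ +
      invFactorialProd (q₁ - 1) (q₂ - 1) (q₃ - 1) (n - q₁ - q₂ - q₃ + 1) a₁ (a₂ - 1) a₃ +
      invFactorialProd q₁ (q₂ - 1) (q₃ - 1) (n - q₁ - q₂ - q₃) a₁ a₂ a₃ := by
  have key : ∀ b₁ b₂ b₃ c : ℤ, b₁ = q₁ - a₂ - a₃ → b₂ = q₂ - a₃ - a₁ → b₃ = q₃ - a₁ - a₂ →
      c = n - q₁ - q₂ - q₃ + a₁ + a₂ + a₃ →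
      ((q₂ * q₃ - a₃ * (q₃ - a₁) : ℤ) : ℚ) = a₁ * (n - b₁ - c) + b₂ * (a₂ + b₃) := by
    rintro _ _ _ _ rfl rfl rfl rfl
    push_cast
    ring
  rw [key _ _ _ _ rfl rfl rfl rfl]
  simp only [invFactorialProd]
  rw [show q₂ - 1 - a₃ - (a₁ - 1) = q₂ - a₃ - a₁ by ring,
    show q₃ - 1 - (a₁ - 1) - a₂ = q₃ - a₁ - a₂ by ring,
    show n - q₁ - q₂ - q₃ + 1 + (a₁ - 1) + a₂ + a₃ = n - q₁ - q₂ - q₃ + a₁ + a₂ + a₃ by ring,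
    show q₁ - 1 - a₂ - a₃ = q₁ - a₂ - a₃ - 1 by ring,
    show n - q₁ - q₂ - q₃ + (a₁ - 1) + a₂ + a₃ = n - q₁ - q₂ - q₃ + a₁ + a₂ + a₃ - 1 by ring,
    show q₁ - 1 - (a₂ - 1) - a₃ = q₁ - a₂ - a₃ by ring,
    show q₂ - 1 - a₃ - a₁ = q₂ - a₃ - a₁ - 1 by ring,
    show q₃ - 1 - a₁ - (a₂ - 1) = q₃ - a₁ - a₂ by ring,
    show n - q₁ - q₂ - q₃ + 1 + a₁ + (a₂ - 1) + a₃ = n - q₁ - q₂ - q₃ + a₁ + a₂ + a₃ by ring,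
    show q₃ - 1 - a₁ - a₂ = q₃ - a₁ - a₂ - 1 by ring]
  simp only [← mul_invFactorial]
  ring

/-- The weighted sum of `invFactorialProd` over a box that contains its support. -/
theorem sum_weight_mul_invFactorialProd (n q₁ : ℤ) (q₂ q₃ B : ℕ) (h₃ : q₃ < B) :
    ∑ a₁ ∈ range B, ∑ a₂ ∈ range B, ∑ a₃ ∈ range B,
        (((q₂ : ℤ) * q₃ - (a₃ : ℤ) * ((q₃ : ℤ) - a₁) : ℤ) : ℚ) *
          invFactorialProd q₁ q₂ q₃ (n - q₁ - q₂ - q₃) a₁ a₂ a₃ =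
      n * ∑ a₁ ∈ range B, ∑ a₂ ∈ range B, ∑ a₃ ∈ range B,
        invFactorialProd q₁ (q₂ - 1) (q₃ - 1) (n - q₁ - q₂ - q₃ + 1) a₁ a₂ a₃ := by
  have shift₁ : ∀ r₁ c : ℤ,
      ∑ a₁ ∈ range B, ∑ a₂ ∈ range B, ∑ a₃ ∈ range B,
        invFactorialProd r₁ (q₂ - 1) (q₃ - 1) c ((a₁ : ℤ) - 1) a₂ a₃ =
      ∑ a₁ ∈ range B, ∑ a₂ ∈ range B, ∑ a₃ ∈ range B,
        invFactorialProd r₁ (q₂ - 1) (q₃ - 1) c a₁ a₂ a₃ := fun r₁ c => by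
    rw [sum_range_eq_sum_range_add_one]
    · simp only [Nat.cast_add, Nat.cast_one, add_sub_cancel_right]
    · exact Finset.sum_eq_zero fun a₂ _ => Finset.sum_eq_zero fun a₃ _ =>
        invFactorialProd_eq_zero (by lia)
    · exact Finset.sum_eq_zero fun a₂ _ => Finset.sum_eq_zero fun a₃ _ =>
        invFactorialProd_eq_zero (by lia)
  have shift₂ : ∀ r₁ c : ℤ,
      ∑ a₁ ∈ range B, ∑ a₂ ∈ range B, ∑ a₃ ∈ range B,
        invFactorialProd r₁ (q₂ - 1) (q₃ - 1) c a₁ ((a₂ : ℤ) - 1) a₃ =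
      ∑ a₁ ∈ range B, ∑ a₂ ∈ range B, ∑ a₃ ∈ range B,
        invFactorialProd r₁ (q₂ - 1) (q₃ - 1) c a₁ a₂ a₃ := fun r₁ c => by
    refine Finset.sum_congr rfl fun a₁ _ => ?_
    rw [sum_range_eq_sum_range_add_one]
    · simp only [Nat.cast_add, Nat.cast_one, add_sub_cancel_right]
    · exact Finset.sum_eq_zero fun a₃ _ => invFactorialProd_eq_zero (by lia)
    · exact Finset.sum_eq_zero fun a₃ _ => invFactorialProd_eq_zero (by lia)
  simp only [weight_mul_invFactorialProd, Finset.sum_add_distrib, Finset.sum_sub_distrib,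
    ← Finset.mul_sum, shift₁, shift₂]
  ring

/-- **Equivalence, for `r = 3`, of the main formula with Jackson's formula**, summed form. -/
theorem r_eq_three_sum_identity
    (n p₁ p₂ p₃ : ℕ) (hn : 1 ≤ n) (hp₁ : 1 ≤ p₁) (hp₂ : 1 ≤ p₂) (hp₃ : 1 ≤ p₃) :
    ((n - 1).factorial : ℤ) ^ 2 *
        ∑ᶠ (a₁ : ℕ), ∑ᶠ (a₂ : ℕ), ∑ᶠ (a₃ : ℕ),
          ((p₂ : ℤ) * p₃ - (a₃ : ℤ) * ((p₃ : ℤ) - a₁)) *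
            extM n ![(a₁ : ℤ), (a₂ : ℤ), (a₃ : ℤ), (p₁ : ℤ) - 1 - a₂ - a₃,
              (p₂ : ℤ) - a₃ - a₁, (p₃ : ℤ) - a₁ - a₂,
              (n : ℤ) + 1 + a₁ + a₂ + a₃ - p₁ - p₂ - p₃]
      = (n.factorial : ℤ) ^ 2 *
        ∑ᶠ (a₁ : ℕ), ∑ᶠ (a₂ : ℕ), ∑ᶠ (a₃ : ℕ),
          extM (n - 1) ![(a₁ : ℤ), (a₂ : ℤ), (a₃ : ℤ), (p₁ : ℤ) - 1 - a₂ - a₃,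
            (p₂ : ℤ) - 1 - a₃ - a₁, (p₃ : ℤ) - 1 - a₁ - a₂,
            (n : ℤ) + 2 + a₁ + a₂ + a₃ - p₁ - p₂ - p₃] := by
  obtain ⟨m, rfl⟩ : ∃ m, n = m + 1 := ⟨n - 1, by lia⟩
  rw [Nat.add_sub_cancel]
  rw [finsum_triple_eq_sum_range (B := p₂ + p₃ + 1), finsum_triple_eq_sum_range (B := p₂ + p₃ + 1)]
  rotate_left
  · intro a₁ a₂ a₃ h
    have h₄ := nonneg_of_extM_ne_zero h 4
    have h₅ := nonneg_of_extM_ne_zero h 5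
    simp at h₄ h₅
    lia
  · intro a₁ a₂ a₃ h
    have h₄ := nonneg_of_extM_ne_zero (right_ne_zero_of_mul h) 4
    have h₅ := nonneg_of_extM_ne_zero (right_ne_zero_of_mul h) 5
    simp at h₄ h₅
    lia
  have hl : ∀ a₁ a₂ a₃ : ℕ,
      (extM (m + 1) ![(a₁ : ℤ), (a₂ : ℤ), (a₃ : ℤ), (p₁ : ℤ) - 1 - a₂ - a₃,
        (p₂ : ℤ) - a₃ - a₁, (p₃ : ℤ) - a₁ - a₂,
        ((m + 1 : ℕ) : ℤ) + 1 + a₁ + a₂ + a₃ - p₁ - p₂ - p₃] : ℚ) =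
      (m + 1).factorial * invFactorialProd (p₁ - 1) p₂ p₃
        (((m + 1 : ℕ) : ℤ) - (p₁ - 1) - p₂ - p₃) a₁ a₂ a₃ := fun a₁ a₂ a₃ => by
    rw [extM_eq_factorial_mul_prod (by simp [Fin.sum_univ_succ]; ring)]
    simp [Fin.prod_univ_succ, invFactorialProd]
    ring_nf
    simp
  have hr : ∀ a₁ a₂ a₃ : ℕ,
      (extM m ![(a₁ : ℤ), (a₂ : ℤ), (a₃ : ℤ), (p₁ : ℤ) - 1 - a₂ - a₃,
        (p₂ : ℤ) - 1 - a₃ - a₁, (p₃ : ℤ) - 1 - a₁ - a₂,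
        ((m + 1 : ℕ) : ℤ) + 2 + a₁ + a₂ + a₃ - p₁ - p₂ - p₃] : ℚ) =
      m.factorial * invFactorialProd (p₁ - 1) (p₂ - 1) (p₃ - 1)
        (((m + 1 : ℕ) : ℤ) - (p₁ - 1) - p₂ - p₃ + 1) a₁ a₂ a₃ := fun a₁ a₂ a₃ => by
    rw [extM_eq_factorial_mul_prod (by simp [Fin.sum_univ_succ]; ring)]
    simp [Fin.prod_univ_succ, invFactorialProd]
    ring_nf
    simp
  have key := sum_weight_mul_invFactorialProd ((m + 1 : ℕ) : ℤ) (p₁ - 1) p₂ p₃ (p₂ + p₃ + 1)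
    (by lia)
  rw [← Int.cast_inj (α := ℚ)]
  simp only [Int.cast_mul, Int.cast_pow, Int.cast_sum, hl, hr,
    mul_left_comm _ (((m + 1).factorial : ℕ) : ℚ), ← Finset.mul_sum]
  rw [key, Nat.factorial_succ]
  push_cast
  ring
end

section
/- For all integers n ≥ 1 and r ≥ 1, let c_{p₁,…,p_r} denote the coefficient of the monomial x₁^{p₁}⋯x_r^{p_r} in the polynomial x₁x₂⋯x_r · (Π_{i=1}^r (1 + x_i) − Π_{i=1}^r x_i)^{n−1} in the indeterminates x₁,…,x_r with integer coefficients. Then for all non-negative integers x₁,…,x_r: Σ_{p₁,…,p_r ≥ 1} k^n_{p₁,…,p_r} · Π_{i=1}^r x_i^{p_i} = (n!)^{r−1} · Σ_{p₁,…,p_r ≥ 1} c_{p₁,…,p_r} · Π_{i=1}^r binom(x_i, p_i). -/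
open Finset

/-- The number of cycles (orbits, fixed points included) of a permutation of `Fin n`. -/
def cycleCount {n : ℕ} (α : Equiv.Perm (Fin n)) : ℕ :=
  (Equiv.Perm.partition α).parts.card

/-- `numFactorizations n r p` is the number `k^n_{p₁,…,p_r}` of `r`-tuples of permutations
of `{1,…,n}` whose (left-to-right) product is the long cycle `(1 2 … n)` and whose `i`-th
component has exactly `p i` cycles. -/
noncomputable def numFactorizations (n r : ℕ) (p : Fin r → ℕ) : ℕ :=
  Nat.card {α : Fin r → Equiv.Perm (Fin n) //
    (List.ofFn α).prod = finRotate n ∧ ∀ i, cycleCount (α i) = p i}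

/-- `jacksonCoeff n r p` is the coefficient of the monomial `x₁^{p₁}⋯x_r^{p_r}` in the
polynomial `x₁x₂⋯x_r (∏ᵢ (1 + xᵢ) - ∏ᵢ xᵢ)^{n-1} ∈ ℤ[x₁,…,x_r]`. -/
noncomputable def jacksonCoeff (n r : ℕ) (p : Fin r → ℕ) : ℤ :=
  MvPolynomial.coeff (Finsupp.equivFunOnFinite.symm p)
    ((∏ i : Fin r, MvPolynomial.X i) *
      ((∏ i : Fin r, (1 + MvPolynomial.X i)) -
          ∏ i : Fin r, (MvPolynomial.X i : MvPolynomial (Fin r) ℤ)) ^ (n - 1))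

theorem cycleCount_eq {n : ℕ} (σ : Equiv.Perm (Fin n)) :
    cycleCount σ = Multiset.card σ.cycleType + (n - #σ.support) := by
  simp [cycleCount, Equiv.Perm.parts_partition]

/-- The embedding of `Perm (Fin n)` into `Perm (Fin (n + 1))` as the stabilizer of `0`. -/
def Equiv.Perm.embedSucc (n : ℕ) : Equiv.Perm (Fin n) →* Equiv.Perm (Fin (n + 1)) where
  toFun σ := Equiv.Perm.decomposeFin.symm (0, σ)
  map_one' := by
    ext i
    refine Fin.cases ?_ (fun i => ?_) i <;> simp
  map_mul' σ τ := by
    ext i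
    refine Fin.cases ?_ (fun i => ?_) i <;> simp

namespace Equiv.Perm

@[simp] theorem embedSucc_apply_zero {n : ℕ} (σ : Perm (Fin n)) : embedSucc n σ 0 = 0 := by
  simp [embedSucc]

@[simp] theorem embedSucc_apply_succ {n : ℕ} (σ : Perm (Fin n)) (i : Fin n) :
    embedSucc n σ i.succ = (σ i).succ := by
  simp [embedSucc]

theorem decomposeFin_symm_eq_swap_mul {n : ℕ} (p : Fin (n + 1)) (σ : Perm (Fin n)) :
    decomposeFin.symm (p, σ) = swap 0 p * embedSucc n σ := by
  ext i
  refine Fin.cases ?_ (fun i => ?_) i <;> simp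

theorem embedSucc_swap {n : ℕ} (a b : Fin n) :
    embedSucc n (swap a b) = swap a.succ b.succ := by
  ext i
  refine Fin.cases ?_ (fun i => ?_) i
  · rw [embedSucc_apply_zero, swap_apply_of_ne_of_ne] <;> simp [Fin.succ_ne_zero, eq_comm]
  · rw [embedSucc_apply_succ, (Fin.succ_injective n).map_swap]

theorem embedSucc_eq_extendDomain {n : ℕ} (σ : Perm (Fin n)) :
    embedSucc n σ = σ.extendDomain (finSuccAboveEquiv (0 : Fin (n + 1))) := by
  ext i
  refine Fin.cases ?_ (fun i => ?_) i
  · rw [extendDomain_apply_not_subtype _ _ (by simp)]; simp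
  · have := extendDomain_apply_image σ (finSuccAboveEquiv (0 : Fin (n + 1))) i
    simp only [finSuccAboveEquiv_apply, Fin.zero_succAbove] at this
    rw [this]; simp

theorem cycleType_embedSucc {n : ℕ} (σ : Perm (Fin n)) :
    (embedSucc n σ).cycleType = σ.cycleType := by
  rw [embedSucc_eq_extendDomain, cycleType_extendDomain]

/-- Multiplying `τ` by a transposition of a fixed point of `τ` with another point lowers
`n - #cycles` by one. -/
theorem card_cycleType_swap_mul {α : Type*} [Fintype α] [DecidableEq α] (τ : Perm α) {a p : α}
    (ha : τ a = a) (hp : p ≠ a) :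
    Multiset.card (swap a p * τ).cycleType + #τ.support + 1 =
      Multiset.card τ.cycleType + #(swap a p * τ).support := by
  by_cases hτ : τ p = p
  · have hd : Disjoint (swap a p) τ := by
      intro x
      by_cases h1 : x = a
      · right; rw [h1, ha]
      by_cases h2 : x = p
      · right; rw [h2, hτ]
      · left; exact swap_apply_of_ne_of_ne h1 h2
    rw [hd.cycleType_mul, hd.card_support_mul, card_support_swap hp.symm,
      (isCycle_swap hp.symm).cycleType]
    simp; omega
  · have hps : p ∈ τ.support := mem_support.2 hτ
    set c := τ.cycleOf p with hc
    set ρ := c⁻¹ * τ with hρ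
    have hcτ : τ = c * ρ := by simp [hρ]
    have hcc : c.IsCycle := isCycle_cycleOf _ hτ
    have hmem : c ∈ τ.cycleFactorsFinset := cycleOf_mem_cycleFactorsFinset_iff.2 hps
    have hd : Disjoint c ρ := by
      rw [hρ]
      have h := disjoint_mul_inv_of_mem_cycleFactorsFinset hmem
      have h2 := self_mem_cycle_factors_commute hmem
      have : c⁻¹ * τ = τ * c⁻¹ := (h2.inv_left).eq
      rw [this]; exact h.symm
    have hac : c a = a := by
      rw [hc, cycleOf_apply]
      split_ifs <;> simp [ha]
    have hρa : ρ a = a := by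
      rw [hρ, mul_apply, ha, inv_eq_iff_eq, hac]
    have hl : ∃ l : List α, τ.toList p = p :: l := by
      cases h : τ.toList p with
      | nil => exact absurd hps (toList_eq_nil_iff.1 h)
      | cons y l =>
        refine ⟨l, ?_⟩
        have := toList_getElem_zero (p := τ) (x := p) hps
        simp only [h, List.getElem_cons_zero] at this
        rw [this]
    obtain ⟨l, hl⟩ := hl
    have hform : swap a p * c = List.formPerm (a :: p :: l) := by
      rw [List.formPerm_cons_cons, ← hl, formPerm_toList]
    have hanl : a ∉ p :: l := by
      rw [← hl, mem_toList_iff]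
      rintro ⟨h1, -⟩
      have := (h1.symm.apply_eq_self_iff).1 ha
      exact hτ this
    have hnd : (a :: p :: l).Nodup := List.nodup_cons.2 ⟨hanl, hl ▸ nodup_toList τ p⟩
    have hcyc : (swap a p * c).IsCycle := by
      rw [hform]; exact List.isCycle_formPerm hnd (by simp)
    have hlen : c.support.card = (p :: l).length := by
      rw [← hl, length_toList]
    have hsup : (swap a p * c).support.card = (a :: p :: l).length := by
      rw [hform, List.support_formPerm_of_nodup _ hnd (by simp), List.toFinset_card_of_nodup hnd]
    have hd' : Disjoint (swap a p * c) ρ := by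
      rw [disjoint_iff_disjoint_support, Finset.disjoint_left]
      intro x hx
      rw [hform, List.support_formPerm_of_nodup _ hnd (by simp), List.mem_toFinset] at hx
      rcases List.mem_cons.1 hx with rfl | hx
      · simp [hρa]
      · rw [← hl, mem_toList_iff] at hx
        have : x ∈ c.support := by rw [hc, mem_support_cycleOf_iff]; exact hx
        exact Finset.disjoint_left.1 hd.disjoint_support this
    rw [hcτ, ← mul_assoc, hd.cycleType_mul, hd.card_support_mul, hd'.cycleType_mul,
      hd'.card_support_mul, hcyc.cycleType, hcc.cycleType, hsup, hlen]
    simp; omega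

end Equiv.Perm

theorem cycleCount_decomposeFin_symm {n : ℕ} (p : Fin (n + 1)) (σ : Equiv.Perm (Fin n)) :
    cycleCount (Equiv.Perm.decomposeFin.symm (p, σ)) =
      cycleCount σ + if p = 0 then 1 else 0 := by
  have h0 : #(Equiv.Perm.embedSucc n σ).support = #σ.support := by
    rw [← Equiv.Perm.sum_cycleType, Equiv.Perm.cycleType_embedSucc, Equiv.Perm.sum_cycleType]
  have h1 : #σ.support ≤ n := by simpa using σ.support.card_le_univ
  rw [cycleCount_eq, cycleCount_eq, Equiv.Perm.decomposeFin_symm_eq_swap_mul]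
  split_ifs with hp
  · subst hp
    simp only [Equiv.swap_self]
    change Multiset.card (1 * Equiv.Perm.embedSucc n σ).cycleType +
      (n + 1 - #(1 * Equiv.Perm.embedSucc n σ).support) = _
    rw [one_mul, h0, Equiv.Perm.cycleType_embedSucc]
    omega
  · have h := Equiv.Perm.card_cycleType_swap_mul (Equiv.Perm.embedSucc n σ)
      (Equiv.Perm.embedSucc_apply_zero σ) hp
    have h2 : #(Equiv.swap 0 p * Equiv.Perm.embedSucc n σ).support ≤ n + 1 := by
      simpa using (Equiv.swap 0 p * Equiv.Perm.embedSucc n σ).support.card_le_univ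
    rw [Equiv.Perm.cycleType_embedSucc, h0] at h
    omega

theorem one_le_cycleCount {n : ℕ} (σ : Equiv.Perm (Fin (n + 1))) : 1 ≤ cycleCount σ := by
  rw [cycleCount, Nat.one_le_iff_ne_zero, Ne, Multiset.card_eq_zero]
  intro h
  have := (Equiv.Perm.partition σ).parts_sum
  simp [h] at this

theorem cycleCount_eq_of_isConj {n : ℕ} {σ τ : Equiv.Perm (Fin n)} (h : IsConj σ τ) :
    cycleCount σ = cycleCount τ := by
  rw [cycleCount_eq, cycleCount_eq, ← Equiv.Perm.sum_cycleType, ← Equiv.Perm.sum_cycleType,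
    Equiv.Perm.isConj_iff_cycleType_eq.1 h]

/-- If `v` is a common eigenvector of the operators `∑_{a > m} ρ (swap m a)` (Jucys–Murphy
elements), then it is an eigenvector of `∑ α, x ^ cycleCount α • ρ α`. -/
theorem sum_pow_cycleCount_smul {M : Type*} [AddCommGroup M] [Module ℚ M] (x : ℚ) :
    ∀ {n : ℕ} (ρ : Equiv.Perm (Fin n) →* Module.End ℚ M) (v : M) (κ : Fin n → ℚ),
      (∀ m, ∑ a with m < a, ρ (Equiv.swap m a) v = κ m • v) →
      ∑ α, x ^ cycleCount α • ρ α v = (∏ m, (x + κ m)) • v := by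
  intro n
  induction n with
  | zero =>
    intro ρ v κ _
    have h1 : (default : Equiv.Perm (Fin 0)) = 1 := Subsingleton.elim _ _
    rw [Fintype.sum_unique, h1, map_one, cycleCount_eq]
    simp
  | succ n ih =>
    intro ρ v κ h
    have ih' := ih (ρ.comp (Equiv.Perm.embedSucc n)) v (fun m => κ m.succ) (by
      intro m
      rw [← h m.succ, Finset.sum_filter, Finset.sum_filter, Fin.sum_univ_succ]
      simp [Equiv.Perm.embedSucc_swap])
    have h0 := h 0
    rw [Finset.sum_filter, Fin.sum_univ_succ] at h0
    simp only [lt_irrefl, if_false, zero_add, Fin.succ_pos, if_true] at h0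
    calc ∑ α, x ^ cycleCount α • ρ α v
        = ∑ p, ∑ σ, (x ^ (if p = 0 then 1 else 0) • ρ (Equiv.swap 0 p))
            (x ^ cycleCount σ • ρ (Equiv.Perm.embedSucc n σ) v) := by
          rw [← Equiv.sum_comp Equiv.Perm.decomposeFin.symm, Fintype.sum_prod_type]
          refine Finset.sum_congr rfl fun p _ => Finset.sum_congr rfl fun σ _ => ?_
          rw [cycleCount_decomposeFin_symm, Equiv.Perm.decomposeFin_symm_eq_swap_mul, map_mul,
            pow_add, LinearMap.smul_apply, map_smul, smul_smul, mul_comm, Module.End.mul_apply]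
      _ = (∏ m : Fin n, (x + κ m.succ)) • ((x + κ 0) • v) := by
          simp only [← map_sum]
          simp only [MonoidHom.comp_apply] at ih'
          rw [ih', Fin.sum_univ_succ]
          simp only [map_smul, ← Finset.smul_sum, ← smul_add]
          congr 1
          have h1 : ρ (Equiv.refl (Fin (n + 1))) = 1 := map_one ρ
          simp [h1, Fin.succ_ne_zero, h0, add_smul]
      _ = _ := by rw [smul_smul, Fin.prod_univ_succ, mul_comm]

theorem AlternatingMap.map_add_smul_const {ι R M N : Type*} [Fintype ι] [DecidableEq ι]
    [CommRing R] [AddCommGroup M] [Module R M] [AddCommGroup N] [Module R N]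
    (f : M [⋀^ι]→ₗ[R] N) (v : ι → M) (c : ι → R) (r : M) :
    f (fun i => v i + c i • r) = f v + ∑ i, c i • f (Function.update v i r) := by
  have h := f.toMultilinearMap.map_add_eq_map_add_linearDeriv_add v (fun i => c i • r)
  rw [MultilinearMap.linearDeriv_apply, Finset.sum_eq_zero (s := Finset.filter _ _)] at h
  · simpa [Pi.add_def] using h
  · intro s hs
    obtain ⟨i, hi, j, hj, hij⟩ := Finset.one_lt_card.1 (Finset.mem_filter.1 hs).2
    set u : ι → M := s.piecewise (fun i => c i • r) v with hu
    have hui : u i = c i • r := by simp [hu, hi]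
    have huj : u j = c j • r := by simp [hu, hj]
    have e : u = Function.update (Function.update u i (c i • r)) j (c j • r) := by
      rw [← hui, ← huj, Function.update_eq_self, Function.update_eq_self]
    change f u = 0
    rw [e, f.map_update_smul, Function.update_comm hij, f.map_update_smul,
      f.map_eq_zero_of_eq (i := i) (j := j) _ _ hij, smul_zero, smul_zero]
    simp [hij.symm]

/-- An orthogonal basis of the hyperplane of vectors with coordinate sum zero in `ℚ ^ (N + 1)`. -/
def hookVec (N : ℕ) (i : Fin N) (b : Fin (N + 1)) : ℚ :=
  if b < i.castSucc then 0 else if b = i.castSucc then (N : ℚ) - i else -1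

/-- The eigenvalue of the star Laplacian centred at `m`, with leaves `a > m`, on
`hookVec N i`. -/
def starEigenvalue (N : ℕ) (m : Fin (N + 1)) (i : Fin N) : ℚ :=
  if m < i.castSucc then 1 else if m = i.castSucc then (N : ℚ) - i + 1 else 0

theorem card_filter_lt {N : ℕ} (m : Fin (N + 1)) :
    (#{a | m < a} : ℚ) = (N : ℚ) - m := by
  have h : ({a | m < a} : Finset (Fin (N + 1))) = Finset.Ioi m := by ext; simp
  rw [h, Fin.card_Ioi]
  have := m.is_lt
  rw [Nat.add_sub_cancel, Nat.cast_sub (by omega)]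

theorem sum_hookVec_mul {N : ℕ} (i : Fin N) (y : Fin (N + 1) → ℚ) :
    ∑ b, hookVec N i b * y b
      = ((N : ℚ) - i) * y i.castSucc - ∑ b with i.castSucc < b, y b := by
  rw [Finset.sum_filter, ← Finset.add_sum_erase _ _ (Finset.mem_univ i.castSucc),
    ← Finset.add_sum_erase (a := i.castSucc) _ (fun b => if i.castSucc < b then y b else 0)
      (Finset.mem_univ _), sub_eq_add_neg]
  simp only [lt_irrefl, if_false, zero_add, ← Finset.sum_neg_distrib]
  congr 1
  · simp [hookVec]
  · refine Finset.sum_congr rfl fun b hb => ?_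
    have hb' := Finset.ne_of_mem_erase hb
    rcases lt_or_gt_of_ne hb' with h | h
    · simp [hookVec, h, not_lt.2 h.le]
    · simp [hookVec, h, not_lt.2 h.le, hb']

theorem sum_hookVec {N : ℕ} (i : Fin N) : ∑ b, hookVec N i b = 0 := by
  have h := sum_hookVec_mul i (fun _ => 1)
  simp only [mul_one, Finset.sum_const, nsmul_eq_mul, card_filter_lt] at h
  simpa using h

theorem sum_star_hookVec {N : ℕ} (m : Fin (N + 1)) (i : Fin N) (y : Fin (N + 1) → ℚ) :
    ∑ a with m < a, (hookVec N i m - hookVec N i a) * (y m - y a)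
      = starEigenvalue N m i * ∑ b, hookVec N i b * y b := by
  rcases lt_trichotomy m i.castSucc with h | h | h
  · have h1 : ∀ z : Fin (N + 1) → ℚ,
        ∑ a with m < a, hookVec N i a * z a = ∑ a, hookVec N i a * z a := by
      intro z
      refine Finset.sum_filter_of_ne fun a _ ha => ?_
      by_contra hc
      exact ha (by simp [hookVec, (not_lt.1 hc).trans_lt h])
    have h2 := h1 (fun _ => 1)
    simp only [mul_one, sum_hookVec] at h2
    have h3 : hookVec N i m = 0 := by simp [hookVec, h]
    calc _ = ∑ a with m < a, (hookVec N i a * y a - hookVec N i a * y m) := by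
          refine Finset.sum_congr rfl fun a _ => ?_
          rw [h3]; ring
      _ = _ := by
          rw [Finset.sum_sub_distrib, h1, ← Finset.sum_mul, h2]
          simp [starEigenvalue, h]
  · subst h
    rw [sum_hookVec_mul]
    calc _ = ∑ a with i.castSucc < a, ((N : ℚ) - i + 1) * (y i.castSucc - y a) := by
          refine Finset.sum_congr rfl fun a ha => ?_
          have ha' := (Finset.mem_filter.1 ha).2
          simp [hookVec, not_lt.2 ha'.le, ha'.ne']
      _ = _ := by
          rw [← Finset.mul_sum, Finset.sum_sub_distrib, Finset.sum_const, nsmul_eq_mul,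
            card_filter_lt]
          simp [starEigenvalue]
  · rw [Finset.sum_eq_zero]
    · simp [starEigenvalue, not_lt.2 h.le, h.ne']
    · intro a ha
      have ha' := h.trans (Finset.mem_filter.1 ha).2
      simp [hookVec, not_lt.2 h.le, h.ne', not_lt.2 ha'.le, ha'.ne']

/-- The basis of the hyperplane dual to `hookVec`. -/
def hookDual (N : ℕ) (i : Fin N) (b : Fin (N + 1)) : ℚ :=
  hookVec N i b / (((N : ℚ) - i) * ((N : ℚ) - i + 1))

theorem sum_hookVec_mul_hookDual {N : ℕ} (i j : Fin N) :
    ∑ b, hookVec N i b * hookDual N j b = if i = j then 1 else 0 := by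
  have key : ∑ b, hookVec N i b * hookVec N j b =
      if i = j then ((N : ℚ) - i) * ((N : ℚ) - i + 1) else 0 := by
    have hlt : ∀ i j : Fin N, i < j → ∑ b, hookVec N i b * hookVec N j b = 0 := by
      intro i j hij
      have hij' : i.castSucc < j.castSucc := by simpa using hij
      have h : ∀ b, hookVec N i b * hookVec N j b = - hookVec N j b := by
        intro b
        by_cases hb : b < j.castSucc
        · simp [hookVec, hb]
        · have hb' := hij'.trans_le (not_lt.1 hb)
          simp only [hookVec, not_lt.2 hb'.le, hb'.ne', if_false]; ring
      simp [h, sum_hookVec]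
    split_ifs with h
    · subst h
      rw [sum_hookVec_mul, Finset.sum_congr (g := fun _ => (-1 : ℚ)) rfl, Finset.sum_const,
        nsmul_eq_mul, card_filter_lt]
      · simp [hookVec]; ring
      · intro b hb
        have hb' := (Finset.mem_filter.1 hb).2
        simp [hookVec, not_lt.2 hb'.le, hb'.ne']
    · rcases lt_or_gt_of_ne h with h | h
      · exact hlt i j h
      · rw [← hlt j i h]; exact Finset.sum_congr rfl fun b _ => mul_comm _ _
  simp only [hookDual, ← mul_div_assoc, ← Finset.sum_div]
  rw [key]
  split_ifs with h
  · subst h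
    have h1 : (i : ℚ) < N := by exact_mod_cast i.is_lt
    exact div_self (mul_ne_zero (by linarith) (by linarith))
  · simp

/-- The principal minor with rows and columns in `S` of the matrix of `g`, acting on the
hyperplane of vectors with coordinate sum zero, in the basis `hookVec`. -/
def hookMinor (N : ℕ) (S : Finset (Fin N)) (g : Equiv.Perm (Fin (N + 1))) : ℚ :=
  (Matrix.of fun i j => if i ∈ S then ∑ b, hookVec N i b * hookDual N j (g b)
    else if i = j then 1 else 0).det

theorem hookMinor_one {N : ℕ} (S : Finset (Fin N)) : hookMinor N S 1 = 1 := by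
  rw [hookMinor, ← Matrix.det_one (n := Fin N)]
  congr 1
  ext i j
  simp [sum_hookVec_mul_hookDual, Matrix.one_apply]

theorem sum_hookMinor_mul_swap {N : ℕ} (S : Finset (Fin N)) (g : Equiv.Perm (Fin (N + 1)))
    (m : Fin (N + 1)) :
    ∑ a with m < a, hookMinor N S (g * Equiv.swap m a)
      = ((N : ℚ) - m - ∑ i ∈ S, starEigenvalue N m i) * hookMinor N S g := by
  set A : Fin N → Fin N → ℚ := fun i j =>
    if i ∈ S then ∑ b, hookVec N i b * hookDual N j (g b) else if i = j then 1 else 0 with hA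
  set r : Fin (N + 1) → Fin N → ℚ := fun a j => hookDual N j (g m) - hookDual N j (g a) with hr
  set c : Fin (N + 1) → Fin N → ℚ := fun a i =>
    if i ∈ S then -(hookVec N i m - hookVec N i a) else 0 with hc
  set f := Matrix.detRowAlternating (n := Fin N) (R := ℚ) with hf
  have hg : hookMinor N S g = f A := rfl
  have h1 : ∀ a, m < a → hookMinor N S (g * Equiv.swap m a) =
      f A + ∑ i, c a i • f (Function.update A i (r a)) := by
    intro a ha
    rw [← f.map_add_smul_const]
    change f _ = f _
    congr 1
    ext i j
    by_cases hi : i ∈ S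
    · simp only [Matrix.of_apply, hA, hc, hi, if_true, Pi.add_apply, Pi.smul_apply, smul_eq_mul,
        Equiv.Perm.mul_apply]
      rw [← Equiv.sum_comp (Equiv.swap m a), ← sub_eq_iff_eq_add', ← Finset.sum_sub_distrib,
        ← Finset.sum_subset (Finset.subset_univ {m, a}), Finset.sum_pair ha.ne]
      · simp [hr]; ring
      · intro b _ hb
        simp only [Finset.mem_insert, Finset.mem_singleton, not_or] at hb
        simp [Equiv.swap_apply_of_ne_of_ne hb.1 hb.2]
    · simp [hA, hc, hi]
  rw [Finset.sum_congr rfl fun a ha => h1 a (Finset.mem_filter.1 ha).2, Finset.sum_add_distrib,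
    Finset.sum_const, nsmul_eq_mul, card_filter_lt, hg, sub_mul _ (∑ i ∈ S, _),
    Finset.sum_comm, sub_eq_add_neg (_ * _), Finset.sum_mul, ← Finset.sum_neg_distrib, ← Finset.sum_subset (Finset.subset_univ S)]
  · congr 1
    refine Finset.sum_congr rfl fun i hi => ?_
    have h2 : ∑ a with m < a, c a i • r a = -(starEigenvalue N m i • A i) := by
      ext j
      simp only [Finset.sum_apply, Pi.smul_apply, smul_eq_mul, hc, hi, if_true, hr, Pi.neg_apply,
        hA]
      rw [← sum_star_hookVec m i (fun b => hookDual N j (g b)), ← Finset.sum_neg_distrib]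
      exact Finset.sum_congr rfl fun a _ => by ring
    calc ∑ a with m < a, c a i • f (Function.update A i (r a))
        = f (Function.update A i (∑ a with m < a, c a i • r a)) := by
          simp only [← AlternatingMap.map_update_smul]
          exact (map_sum (f.toMultilinearMap.toLinearMap A i) _ _).symm
      _ = _ := by
          rw [h2, AlternatingMap.map_update_neg, AlternatingMap.map_update_smul,
            Function.update_eq_self, smul_eq_mul]
  · intro i _ hi
    exact Finset.sum_eq_zero fun a _ => by simp [hc, hi]

theorem prod_range_content (x : ℚ) (T : Finset ℕ) (n : ℕ) :
    ∏ t ∈ range n, (if t ∈ T then x - 1 - #{s ∈ T | s < t} else x + t - #{s ∈ T | s < t})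
      = ∏ t ∈ range n, (x + t - #{s ∈ T | s < n}) := by
  induction n with
  | zero => simp
  | succ n ih =>
    rw [Finset.prod_range_succ, ih]
    by_cases hn : n ∈ T
    · have h : ({s ∈ T | s < n + 1} : Finset ℕ) = insert n {s ∈ T | s < n} := by
        ext s
        simp only [Finset.mem_filter, Finset.mem_insert]
        constructor
        · rintro ⟨h1, h2⟩
          rcases (Nat.lt_succ_iff_lt_or_eq.1 h2) with h | h
          · exact Or.inr ⟨h1, h⟩
          · exact Or.inl h
        · rintro (rfl | ⟨h1, h2⟩)
          · exact ⟨hn, Nat.lt_succ_self _⟩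
          · exact ⟨h1, h2.trans (Nat.lt_succ_self _)⟩
      rw [h, Finset.card_insert_of_notMem (by simp), Finset.prod_range_succ', if_pos hn]
      push_cast
      congr 1
      · exact Finset.prod_congr rfl fun t _ => by ring
      · ring
    · have h : ({s ∈ T | s < n + 1} : Finset ℕ) = {s ∈ T | s < n} := by
        refine Finset.filter_congr fun s hs => ?_
        have : s ≠ n := fun h => hn (h ▸ hs)
        omega
      rw [h, Finset.prod_range_succ, if_neg hn]

theorem prod_add_starEigenvalue {N : ℕ} (x : ℚ) (S : Finset (Fin N)) :
    ∏ m : Fin (N + 1), (x + ((N : ℚ) - m - ∑ i ∈ S, starEigenvalue N m i))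
      = ∏ j ∈ range (N + 1), (x + j - #S) := by
  set T : Finset ℕ := S.image fun i : Fin N => N - (i : ℕ) with hT
  have hinj : Set.InjOn (fun i : Fin N => N - (i : ℕ)) S := by
    intro i _ j _ h
    simp only at h
    ext; omega
  have hcard : ∀ t, #{s ∈ T | s < t} = #(S.filter fun i : Fin N => N - (i : ℕ) < t) := by
    intro t
    rw [hT, Finset.filter_image, Finset.card_image_of_injOn]
    exact hinj.mono (by intro i; simp +contextual)
  have hS : #{s ∈ T | s < N + 1} = #S := by
    rw [hcard, Finset.filter_true_of_mem]
    intro i _; omega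
  rw [← hS, ← prod_range_content, Finset.prod_range, ← Equiv.prod_comp Fin.revPerm]
  refine Finset.prod_congr rfl fun m _ => ?_
  have hm : ((Fin.rev m : Fin (N + 1)) : ℕ) = N - m := by rw [Fin.val_rev]; omega
  have hm' : (((Fin.rev m : Fin (N + 1)) : ℕ) : ℚ) = N - m := by
    rw [hm, Nat.cast_sub (by omega)]
  have hsum : ∑ i ∈ S, starEigenvalue N (Fin.rev m) i =
      #{s ∈ T | s < (m : ℕ)} + if (m : ℕ) ∈ T then (m : ℚ) + 1 else 0 := by
    have h1 : ∀ i : Fin N, starEigenvalue N (Fin.rev m) i =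
        (if N - (i : ℕ) < m then 1 else 0) + if N - (i : ℕ) = m then (m : ℚ) + 1 else 0 := by
      intro i
      have e1 : Fin.rev m < i.castSucc ↔ N - (i : ℕ) < m := by
        rw [Fin.lt_def, hm, Fin.val_castSucc]; omega
      have e2 : Fin.rev m = i.castSucc ↔ N - (i : ℕ) = m := by
        rw [Fin.ext_iff, hm, Fin.val_castSucc]; omega
      simp only [starEigenvalue, e1, e2]
      by_cases h : N - (i : ℕ) < m
      · simp [h, h.ne]
      · by_cases h' : N - (i : ℕ) = m
        · simp [← h', Nat.cast_sub i.is_lt.le]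
        · simp [h, h']
    rw [Finset.sum_congr rfl fun i _ => h1 i, Finset.sum_add_distrib, Finset.sum_boole, hcard]
    congr 1
    rw [← Finset.sum_image (f := fun s => if s = (m : ℕ) then (m : ℚ) + 1 else 0) hinj,
      Finset.sum_ite_eq']
  simp only [Fin.revPerm_apply, hsum, hm']
  split_ifs <;> ring

/-- The representation of `G` on functions `G → ℚ` by right translations. -/
def rightTranslation (G : Type*) [Group G] : G →* Module.End ℚ (G → ℚ) where
  toFun α :=
    { toFun := fun F g => F (g * α)
      map_add' := fun _ _ => rfl
      map_smul' := fun _ _ => rfl }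
  map_one' := by ext; simp
  map_mul' α β := by ext; simp [mul_assoc]

theorem sum_pow_cycleCount_mul_hookMinor {N : ℕ} (x : ℚ) (S : Finset (Fin N))
    (g : Equiv.Perm (Fin (N + 1))) :
    ∑ α, x ^ cycleCount α * hookMinor N S (g * α)
      = (∏ j ∈ range (N + 1), (x + j - #S)) * hookMinor N S g := by
  have h := sum_pow_cycleCount_smul x (rightTranslation (Equiv.Perm (Fin (N + 1))))
    (hookMinor N S) (fun m => (N : ℚ) - m - ∑ i ∈ S, starEigenvalue N m i) (by
      intro m
      ext g
      simpa [rightTranslation] using sum_hookMinor_mul_swap S g m)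
  rw [prod_add_starEigenvalue] at h
  simpa [rightTranslation] using congrFun h g

theorem sum_prod_pow_cycleCount_mul_hookMinor {N : ℕ} (S : Finset (Fin N)) :
    ∀ {r : ℕ} (x : Fin r → ℚ) (g : Equiv.Perm (Fin (N + 1))),
      ∑ α : Fin r → Equiv.Perm (Fin (N + 1)),
          (∏ i, x i ^ cycleCount (α i)) * hookMinor N S (g * (List.ofFn α).prod)
        = (∏ i, ∏ j ∈ range (N + 1), (x i + j - #S)) * hookMinor N S g := by
  intro r
  induction r with
  | zero => intro x g; simp
  | succ r ih =>
    intro x g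
    rw [← Equiv.sum_comp (Fin.consEquiv _), Fintype.sum_prod_type]
    simp only [Fin.consEquiv_apply, Fin.prod_univ_succ, Fin.cons_zero, Fin.cons_succ,
      List.ofFn_succ, List.prod_cons, ← mul_assoc]
    have h : ∀ α : Equiv.Perm (Fin (N + 1)), _ := fun α => ih (fun i => x i.succ) (g * α)
    simp only [mul_assoc, ← Finset.mul_sum] at h ⊢
    simp only [h, mul_left_comm (x 0 ^ _)]
    rw [← Finset.mul_sum, sum_pow_cycleCount_mul_hookMinor]
    ring

/-- The alternating sum of the hook characters `χ^{(N + 1 - k, 1^k)}`. -/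
def hookTrace (N : ℕ) (g : Equiv.Perm (Fin (N + 1))) : ℚ :=
  ∑ S : Finset (Fin N), (-1) ^ #S * hookMinor N S g

theorem hookTrace_eq_det {N : ℕ} (g : Equiv.Perm (Fin (N + 1))) :
    hookTrace N g =
      (1 - Matrix.of fun i j => ∑ b, hookVec N i b * hookDual N j (g b)).det := by
  set E : Fin N → Fin N → ℚ := fun i j => ∑ b, hookVec N i b * hookDual N j (g b) with hE
  set I : Fin N → Fin N → ℚ := fun i j => if i = j then 1 else 0 with hI
  set f := Matrix.detRowAlternating (n := Fin N) (R := ℚ) with hf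
  have h1 : (1 - Matrix.of E).det = f ((fun i => (-1 : ℚ) • E i) + I) := by
    change _ = Matrix.det _
    congr 1
    ext i j
    simp [hI, Matrix.one_apply, sub_eq_neg_add]
  rw [h1]
  have h2 := f.toMultilinearMap.map_add_univ (fun i => (-1 : ℚ) • E i) I
  refine Eq.trans ?_ h2.symm
  refine Finset.sum_congr rfl fun S _ => ?_
  have h3 := f.toMultilinearMap.map_piecewise_smul (fun _ => (-1 : ℚ)) (S.piecewise E I) S
  have h4 : S.piecewise (fun i => (-1 : ℚ) • (S.piecewise E I) i) (S.piecewise E I)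
      = S.piecewise (fun i => (-1 : ℚ) • E i) I := by
    ext i j
    by_cases hi : i ∈ S <;> simp [hi]
  rw [h4] at h3
  rw [h3, Finset.prod_const, smul_eq_mul]
  congr 1
  change Matrix.det _ = Matrix.det _
  congr 1
  ext i j
  by_cases hi : i ∈ S <;> simp [hi, hE, hI]

theorem sum_hookDual_mul_hookVec {N : ℕ} (b b' : Fin (N + 1)) :
    ∑ i, hookDual N i b * hookVec N i b' = (if b = b' then 1 else 0) - 1 / ((N : ℚ) + 1) := by
  have hN : (N : ℚ) + 1 ≠ 0 := by positivity
  let W : Matrix (Option (Fin N)) (Fin (N + 1)) ℚ :=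
    Matrix.of fun o b => o.elim 1 fun i => hookVec N i b
  let V : Matrix (Fin (N + 1)) (Option (Fin N)) ℚ :=
    Matrix.of fun b o => o.elim (1 / ((N : ℚ) + 1)) fun i => hookDual N i b
  have h : W * V = 1 := by
    ext o o'
    rw [Matrix.mul_apply]
    rcases o with _ | i <;> rcases o' with _ | j
    · simp [W, V, hN]
    · simp [W, V, hookDual, ← Finset.sum_div, sum_hookVec]
    · simp [W, V, ← Finset.sum_mul, sum_hookVec]
    · simp [W, V, sum_hookVec_mul_hookDual, Matrix.one_apply]
  have h' : V * W = 1 := (Matrix.mul_eq_one_comm_of_equiv (finSuccEquiv N).symm).1 h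
  have h2 := congrFun (congrFun h' b) b'
  rw [Matrix.mul_apply, Fintype.sum_option, Matrix.one_apply] at h2
  simp only [W, V, Matrix.of_apply, Option.elim] at h2
  rw [← h2]; ring

theorem isConj_finRotate_of_sameCycle {N : ℕ} {g : Equiv.Perm (Fin (N + 1))}
    (h : ∀ b, g.SameCycle 0 b) : IsConj g (finRotate (N + 1)) := by
  rcases N with _ | N
  · have : g = finRotate (0 + 1) := Equiv.ext fun b => Subsingleton.elim (α := Fin 1) _ _
    rw [this]
  · have h0 : ∀ b, g b ≠ b := by
      intro b hb
      have h1 : ∀ c, c = b := fun c =>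
        ((((h b).symm.trans (h c)).eq_of_left hb)).symm
      exact absurd ((h1 0).trans (h1 1).symm) (by simp)
    have hc : g.IsCycle := ⟨0, h0 0, fun b _ => h b⟩
    have hs : g.support = Finset.univ := by
      ext b; simp [h0]
    rw [Equiv.Perm.isConj_iff_cycleType_eq, cycleType_finRotate, hc.cycleType, hs]
    simp

theorem hookTrace_eq_zero {N : ℕ} {g : Equiv.Perm (Fin (N + 1))}
    (hg : ¬ IsConj g (finRotate (N + 1))) : hookTrace N g = 0 := by
  classical
  obtain ⟨b₀, hb₀⟩ : ∃ b, ¬ g.SameCycle 0 b := by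
    by_contra! hc
    exact hg (isConj_finRotate_of_sameCycle hc)
  let y : Fin (N + 1) → ℚ := fun b => if g.SameCycle 0 b then 1 else 0
  have hy : ∀ b, y (g b) = y b := fun b => by simp [y]
  set z : Fin N → ℚ := fun i => ∑ b, hookDual N i b * y b with hz
  have hexp : ∀ b', ∑ i, z i * hookVec N i b' = y b' - (∑ b, y b) / ((N : ℚ) + 1) := by
    intro b'
    simp only [hz, Finset.sum_mul]
    rw [Finset.sum_comm]
    have : ∀ b, ∑ i, hookDual N i b * y b * hookVec N i b' =
        (if b = b' then y b else 0) - y b / ((N : ℚ) + 1) := by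
      intro b
      have := congrArg (y b * ·) (sum_hookDual_mul_hookVec b b')
      simp only [Finset.mul_sum] at this
      rw [Finset.sum_congr rfl fun i _ => by rw [mul_right_comm, mul_comm], this]
      split_ifs <;> ring
    rw [Finset.sum_congr rfl fun b _ => this b, Finset.sum_sub_distrib, Finset.sum_ite_eq',
      if_pos (Finset.mem_univ _), Finset.sum_div]
  rw [hookTrace_eq_det, ← Matrix.exists_vecMul_eq_zero_iff]
  refine ⟨z, ?_, ?_⟩
  · intro h0
    have h1 := hexp 0
    have h2 := hexp b₀
    simp only [h0, Pi.zero_apply, zero_mul, Finset.sum_const_zero] at h1 h2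
    have h3 : y 0 = y b₀ := by linarith
    simp [y, hb₀, Equiv.Perm.SameCycle.refl] at h3
  · rw [Matrix.vecMul_sub, Matrix.vecMul_one, sub_eq_zero]
    ext j
    rw [Matrix.vecMul, dotProduct]
    simp only [Matrix.of_apply, Finset.mul_sum, ← mul_assoc]
    rw [Finset.sum_comm]
    simp only [← Finset.sum_mul, hexp, sub_mul, Finset.sum_sub_distrib]
    rw [← Finset.mul_sum, Equiv.sum_comp g (hookDual N j)]
    have h1 : ∑ b, hookDual N j b = 0 := by
      simp [hookDual, ← Finset.sum_div, sum_hookVec]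
    rw [h1, mul_zero, sub_zero, hz]
    simp only
    rw [← Equiv.sum_comp g]
    exact Finset.sum_congr rfl fun b _ => by rw [hy, mul_comm]

theorem sum_hookTrace (N : ℕ) : ∑ g, hookTrace N g = (N + 1).factorial := by
  simp only [hookTrace]
  rw [Finset.sum_comm]
  have h : ∀ S : Finset (Fin N), ∑ g, (-1) ^ #S * hookMinor N S g =
      if S = ∅ then ((N + 1).factorial : ℚ) else 0 := by
    intro S
    have h1 := sum_pow_cycleCount_mul_hookMinor 1 S 1
    simp only [one_pow, one_mul, hookMinor_one, mul_one] at h1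
    rw [← Finset.mul_sum, h1]
    split_ifs with hS
    · subst hS
      simp only [Finset.card_empty, pow_zero, one_mul, Nat.cast_zero, sub_zero]
      rw [← Finset.prod_range_add_one_eq_factorial]
      push_cast
      exact Finset.prod_congr rfl fun j _ => add_comm _ _
    · have hpos : 0 < #S := Finset.card_pos.2 (Finset.nonempty_iff_ne_empty.2 hS)
      have hle : #S ≤ N := by simpa using S.card_le_univ
      rw [Finset.prod_eq_zero (i := #S - 1), mul_zero]
      · rw [Finset.mem_range]; omega
      · rw [Nat.cast_sub hpos]; push_cast; ring
  rw [Finset.sum_congr rfl fun S _ => h S, Finset.sum_ite_eq', if_pos (Finset.mem_univ _)]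

theorem factorial_mul_sum_factorizations {N r : ℕ} (x : Fin r → ℚ) :
    ((N + 1).factorial : ℚ) * ∑ α : Fin r → Equiv.Perm (Fin (N + 1)) with
        (List.ofFn α).prod = finRotate (N + 1), ∏ i, x i ^ cycleCount (α i)
      = ∑ S : Finset (Fin N), (-1) ^ #S * ∏ i, ∏ j ∈ range (N + 1), (x i + j - #S) := by
  set P : Equiv.Perm (Fin (N + 1)) → ℚ := fun g =>
    ∑ α : Fin r → Equiv.Perm (Fin (N + 1)) with (List.ofFn α).prod = g,
      ∏ i, x i ^ cycleCount (α i) with hP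
  have hconj : ∀ g h, P (h * g * h⁻¹) = P g := by
    intro g h
    simp only [hP, Finset.sum_filter]
    rw [← Equiv.sum_comp (Equiv.piCongrRight fun _ : Fin r => (MulAut.conj h).toEquiv)]
    refine Finset.sum_congr rfl fun α _ => ?_
    have h1 : (List.ofFn (Equiv.piCongrRight
        (fun _ : Fin r => (MulAut.conj h).toEquiv) α)).prod = h * (List.ofFn α).prod * h⁻¹ := by
      rw [← MulAut.conj_apply, map_list_prod, List.map_ofFn]
      rfl
    rw [h1]
    simp only [mul_left_inj, mul_right_inj]
    congr 1
    refine Finset.prod_congr rfl fun i _ => ?_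
    rw [cycleCount_eq_of_isConj (τ := α i)]
    exact (isConj_iff.2 ⟨h, rfl⟩).symm
  have h1 : ∑ α : Fin r → Equiv.Perm (Fin (N + 1)),
      (∏ i, x i ^ cycleCount (α i)) * hookTrace N (List.ofFn α).prod
        = ∑ S : Finset (Fin N), (-1) ^ #S * ∏ i, ∏ j ∈ range (N + 1), (x i + j - #S) := by
    simp only [hookTrace, Finset.mul_sum]
    rw [Finset.sum_comm]
    refine Finset.sum_congr rfl fun S _ => ?_
    have h := sum_prod_pow_cycleCount_mul_hookMinor S x 1
    simp only [one_mul, hookMinor_one, mul_one] at h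
    rw [← h, Finset.mul_sum]
    exact Finset.sum_congr rfl fun α _ => mul_left_comm _ _ _
  have h2 : ∑ α : Fin r → Equiv.Perm (Fin (N + 1)),
      (∏ i, x i ^ cycleCount (α i)) * hookTrace N (List.ofFn α).prod
        = ∑ g, P g * hookTrace N g := by
    rw [← Finset.sum_fiberwise _ fun α : Fin r → Equiv.Perm (Fin (N + 1)) => (List.ofFn α).prod]
    refine Finset.sum_congr rfl fun g _ => ?_
    rw [hP, Finset.sum_mul]
    exact Finset.sum_congr rfl fun α hα => by rw [(Finset.mem_filter.1 hα).2]
  rw [← h1, h2, ← sum_hookTrace, Finset.sum_mul]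
  refine Finset.sum_congr rfl fun g _ => ?_
  by_cases hg : IsConj g (finRotate (N + 1))
  · obtain ⟨h, hh⟩ := isConj_iff.1 hg
    rw [mul_comm, ← hh]
    exact congrArg (· * hookTrace N g) (hconj g h)
  · rw [hookTrace_eq_zero hg, zero_mul, mul_zero]

theorem finsum_numFactorizations {N r : ℕ} (x : Fin r → ℤ) :
    ∑ᶠ (p : Fin r → ℕ) (_ : ∀ i, 1 ≤ p i),
        (numFactorizations (N + 1) r p : ℤ) * ∏ i, x i ^ p i
      = ∑ α : Fin r → Equiv.Perm (Fin (N + 1)) with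
          (List.ofFn α).prod = finRotate (N + 1), ∏ i, x i ^ cycleCount (α i) := by
  classical
  set A : Finset (Fin r → Equiv.Perm (Fin (N + 1))) :=
    {α | (List.ofFn α).prod = finRotate (N + 1)} with hA
  let key : (Fin r → Equiv.Perm (Fin (N + 1))) → Fin r → ℕ := fun α i => cycleCount (α i)
  have hnum : ∀ p, numFactorizations (N + 1) r p = #{α ∈ A | key α = p} := by
    intro p
    rw [numFactorizations, Nat.card_eq_fintype_card, Fintype.card_subtype, hA,
      Finset.filter_filter]
    simp only [key, funext_iff]
  have hmem : ∀ p, numFactorizations (N + 1) r p ≠ 0 → p ∈ A.image key := by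
    intro p hp
    rw [hnum, Finset.card_ne_zero] at hp
    obtain ⟨α, hα⟩ := hp
    exact Finset.mem_image.2 ⟨α, Finset.mem_filter.1 hα⟩
  have hpos : ∀ p ∈ A.image key, ∀ i, 1 ≤ p i := by
    intro p hp i
    obtain ⟨α, -, rfl⟩ := Finset.mem_image.1 hp
    exact one_le_cycleCount _
  have h1 : ∀ p : Fin r → ℕ, ∑ᶠ (_ : ∀ i, 1 ≤ p i),
      (numFactorizations (N + 1) r p : ℤ) * ∏ i, x i ^ p i
        = (numFactorizations (N + 1) r p : ℤ) * ∏ i, x i ^ p i := by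
    intro p
    rw [finsum_eq_if]
    split_ifs with h
    · rfl
    · by_cases h0 : numFactorizations (N + 1) r p = 0
      · simp [h0]
      · exact absurd (hpos p (hmem p h0)) h
  rw [finsum_congr h1, finsum_eq_sum_of_support_subset (s := A.image key)]
  · refine Eq.trans ?_ (Finset.sum_comp (s := A) (fun p => ∏ i, x i ^ p i) key).symm
    exact Finset.sum_congr rfl fun p _ => by rw [hnum, nsmul_eq_mul]
  · intro p hp
    refine Finset.mem_coe.2 (hmem p fun h0 => hp ?_)
    simp [h0]

/-- The linear map sending the monomial `∏ Xᵢ ^ pᵢ` to `∏ binom(xᵢ, pᵢ)`. -/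
noncomputable def chooseFunctional {r : ℕ} (x : Fin r → ℕ) : MvPolynomial (Fin r) ℤ →ₗ[ℤ] ℤ :=
  (MvPolynomial.basisMonomials (Fin r) ℤ).constr ℤ fun p => ∏ i, ((x i).choose (p i) : ℤ)

theorem chooseFunctional_apply {r : ℕ} (x : Fin r → ℕ) (f : MvPolynomial (Fin r) ℤ) :
    chooseFunctional x f = ∑ p ∈ f.support, f.coeff p * ∏ i, ((x i).choose (p i) : ℤ) := by
  rw [chooseFunctional, Module.Basis.constr_apply]
  rfl

theorem chooseFunctional_monomial {r : ℕ} (x : Fin r → ℕ) (p : Fin r →₀ ℕ) (c : ℤ) :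
    chooseFunctional x (MvPolynomial.monomial p c) = c * ∏ i, ((x i).choose (p i) : ℤ) := by
  have h := (MvPolynomial.basisMonomials (Fin r) ℤ).constr_basis ℤ
    (fun p => ∏ i, ((x i).choose (p i) : ℤ)) p
  rw [MvPolynomial.coe_basisMonomials] at h
  rw [← mul_one c, ← smul_eq_mul, ← MvPolynomial.smul_monomial, map_smul, chooseFunctional, h]
  simp

theorem chooseFunctional_prod_sum {r : ℕ} {ι : Type*} (x : Fin r → ℕ) (s : Finset ι)
    (a : ι → ℤ) (e : ι → ℕ) :
    chooseFunctional x (∏ i, ∑ j ∈ s, MvPolynomial.C (a j) * MvPolynomial.X i ^ e j)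
      = ∏ i, ∑ j ∈ s, a j * ((x i).choose (e j) : ℤ) := by
  classical
  rw [Finset.prod_univ_sum, Finset.prod_univ_sum, map_sum]
  refine Finset.sum_congr rfl fun J _ => ?_
  have h : ∏ i, MvPolynomial.C (a (J i)) * MvPolynomial.X i ^ e (J i) =
      MvPolynomial.monomial (Finsupp.equivFunOnFinite.symm fun i => e (J i)) (∏ i, a (J i)) := by
    rw [MvPolynomial.monomial_eq, Finset.prod_mul_distrib, map_prod, Finsupp.prod_fintype]
    · simp
    · simp
  rw [h, chooseFunctional_monomial, Finset.prod_mul_distrib]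
  simp

theorem sum_choose_mul_choose (x m k : ℕ) :
    ∑ j ∈ range (m + 1), m.choose j * x.choose (k + 1 + j) = (x + m).choose (m + k + 1) := by
  rw [add_comm x m, Nat.add_choose_eq, Finset.Nat.sum_antidiagonal_eq_sum_range_succ_mk,
    ← Finset.sum_range_reflect]
  refine Finset.sum_subset_zero_on_sdiff ?_ ?_ ?_
  · intro i hi
    rw [Finset.mem_range] at *
    omega
  · intro i hi
    simp only [Finset.mem_sdiff, Finset.mem_range] at hi
    rw [Nat.choose_eq_zero_of_lt (by omega), zero_mul]
  · intro i hi
    rw [Finset.mem_range] at hi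
    rw [show m + 1 - 1 - i = m - i by omega, Nat.choose_symm (by omega)]
    congr 2
    omega

theorem chooseFunctional_jackson {N r : ℕ} (x : Fin r → ℕ) :
    chooseFunctional x ((∏ i : Fin r, MvPolynomial.X i) *
      ((∏ i : Fin r, (1 + MvPolynomial.X i)) - ∏ i : Fin r, MvPolynomial.X i) ^ N)
      = ∑ k ∈ range (N + 1), (N.choose k : ℤ) *
          ((-1) ^ k * ∏ i, ((x i + (N - k)).choose (N + 1) : ℤ)) := by
  rw [sub_eq_neg_add, add_pow, Finset.mul_sum, map_sum]
  refine Finset.sum_congr rfl fun k hk => ?_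
  have hk' : k ≤ N := Nat.lt_succ_iff.1 (Finset.mem_range.1 hk)
  have h : (∏ i : Fin r, (MvPolynomial.X i : MvPolynomial (Fin r) ℤ)) *
      ((-∏ i, MvPolynomial.X i) ^ k * (∏ i, (1 + MvPolynomial.X i)) ^ (N - k) *
        (N.choose k : MvPolynomial (Fin r) ℤ))
      = ((N.choose k : ℤ) * (-1) ^ k) • ∏ i, ∑ j ∈ range (N - k + 1),
          MvPolynomial.C ((N - k).choose j : ℤ) * MvPolynomial.X i ^ (k + 1 + j) := by
    have h1 : ∀ i : Fin r, ∑ j ∈ range (N - k + 1),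
        MvPolynomial.C ((N - k).choose j : ℤ) * MvPolynomial.X i ^ (k + 1 + j)
        = (MvPolynomial.X i : MvPolynomial (Fin r) ℤ) ^ (k + 1) *
            (1 + MvPolynomial.X i) ^ (N - k) := by
      intro i
      rw [add_comm (1 : MvPolynomial (Fin r) ℤ), add_pow, Finset.mul_sum]
      refine Finset.sum_congr rfl fun j _ => ?_
      simp only [one_pow, mul_one, map_natCast]
      ring
    simp only [h1]
    rw [Finset.prod_mul_distrib, Finset.prod_pow, Finset.prod_pow, neg_pow (∏ i, _),
      zsmul_eq_mul]
    push_cast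
    ring
  rw [h, map_smul, chooseFunctional_prod_sum, smul_eq_mul, mul_assoc]
  congr 2
  refine Finset.prod_congr rfl fun i _ => ?_
  rw [show N + 1 = (N - k) + k + 1 by omega,
    ← sum_choose_mul_choose]
  push_cast
  rfl

theorem finsum_jacksonCoeff {N r : ℕ} (x : Fin r → ℕ) :
    ∑ᶠ (p : Fin r → ℕ) (_ : ∀ i, 1 ≤ p i),
        jacksonCoeff (N + 1) r p * ∏ i, ((x i).choose (p i) : ℤ)
      = ∑ k ∈ range (N + 1), (N.choose k : ℤ) *
          ((-1) ^ k * ∏ i, ((x i + (N - k)).choose (N + 1) : ℤ)) := by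
  classical
  rw [← chooseFunctional_jackson, chooseFunctional_apply]
  set f : MvPolynomial (Fin r) ℤ := (∏ i : Fin r, MvPolynomial.X i) *
      ((∏ i : Fin r, (1 + MvPolynomial.X i)) - ∏ i : Fin r, MvPolynomial.X i) ^ N with hf
  have hc : ∀ p, jacksonCoeff (N + 1) r p = f.coeff (Finsupp.equivFunOnFinite.symm p) :=
    fun _ => rfl
  have h0 : ∀ p : Fin r → ℕ, ¬ (∀ i, 1 ≤ p i) → jacksonCoeff (N + 1) r p = 0 := by
    intro p hp
    push Not at hp
    obtain ⟨i, hi⟩ := hp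
    rw [hc, hf, ← Finset.mul_prod_erase _ _ (Finset.mem_univ i), mul_assoc, mul_comm,
      MvPolynomial.coeff_mul_X', if_neg]
    simpa [Finsupp.mem_support_iff] using hi
  have h1 : ∀ p : Fin r → ℕ, ∑ᶠ (_ : ∀ i, 1 ≤ p i),
      jacksonCoeff (N + 1) r p * ∏ i, ((x i).choose (p i) : ℤ)
        = jacksonCoeff (N + 1) r p * ∏ i, ((x i).choose (p i) : ℤ) := by
    intro p
    rw [finsum_eq_if]
    split_ifs with h
    · rfl
    · rw [h0 p h, zero_mul]
  rw [finsum_congr h1, finsum_eq_sum_of_support_subset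
    (s := f.support.map Finsupp.equivFunOnFinite.toEmbedding)]
  · rw [Finset.sum_map]
    exact Finset.sum_congr rfl fun p _ => by simp [hc]
  · intro p hp
    have : f.coeff (Finsupp.equivFunOnFinite.symm p) ≠ 0 := by
      intro h
      exact hp (by simp [hc, h])
    simp only [Finset.coe_map, Set.mem_image, Finset.mem_coe, MvPolynomial.mem_support_iff]
    exact ⟨_, this, by simp⟩

theorem prod_range_add_sub {x N k : ℕ} (hk : k ≤ N) :
    ∏ j ∈ range (N + 1), ((x : ℚ) + j - k)
      = (N + 1).factorial * (x + (N - k)).choose (N + 1) := by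
  rw [← Nat.cast_mul, ← Nat.descFactorial_eq_factorial_mul_choose,
    ← Finset.prod_range_reflect]
  by_cases h : k ≤ x
  · rw [Nat.descFactorial_eq_prod_range, Nat.cast_prod]
    refine Finset.prod_congr rfl fun j hj => ?_
    have hj' := Finset.mem_range.1 hj
    rw [show N + 1 - 1 - j = N - j by omega, Nat.cast_sub (by omega), Nat.cast_sub (by omega)]
    push_cast [Nat.cast_sub hk]
    ring
  · rw [Nat.descFactorial_of_lt (by omega), Nat.cast_zero]
    refine Finset.prod_eq_zero (i := N - (k - x)) (Finset.mem_range.2 (by omega)) ?_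
    rw [show N + 1 - 1 - (N - (k - x)) = k - x by omega, Nat.cast_sub (by omega)]
    ring

/-- **Jackson's formula** for factorizations of the long cycle `γ_n`:
`∑_{p ≥ 1} k^n_p ∏ xᵢ^{pᵢ} = n!^{r-1} ∑_{p ≥ 1} c_p ∏ C(xᵢ, pᵢ)` where `c_p` is the
coefficient of `∏ xᵢ^{pᵢ}` in `x₁⋯x_r (∏(1 + xᵢ) - ∏ xᵢ)^{n-1}`. -/
theorem jackson_formula
    (n r : ℕ) (hn : 1 ≤ n) (hr : 1 ≤ r) (x : Fin r → ℕ) :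
    ∑ᶠ (p : Fin r → ℕ) (_ : ∀ i, 1 ≤ p i),
        (numFactorizations n r p : ℤ) * ∏ i, (x i : ℤ) ^ p i
      = (n.factorial : ℤ) ^ (r - 1) *
        ∑ᶠ (p : Fin r → ℕ) (_ : ∀ i, 1 ≤ p i),
          jacksonCoeff n r p * ∏ i, ((x i).choose (p i) : ℤ) := by
  obtain ⟨N, rfl⟩ : ∃ N, n = N + 1 := ⟨n - 1, by omega⟩
  obtain ⟨s, rfl⟩ : ∃ s, r = s + 1 := ⟨r - 1, by omega⟩
  rw [finsum_numFactorizations, finsum_jacksonCoeff, Nat.add_sub_cancel]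
  have hfac : ((N + 1).factorial : ℚ) ≠ 0 := by exact_mod_cast (Nat.factorial_ne_zero _)
  have h := factorial_mul_sum_factorizations (N := N) fun i => (x i : ℚ)
  have h1 : ∀ S : Finset (Fin N), (-1 : ℚ) ^ #S *
      ∏ i, ∏ j ∈ range (N + 1), ((x i : ℚ) + j - #S) =
        (fun k => (-1 : ℚ) ^ k * ∏ i, ((N + 1).factorial * (x i + (N - k)).choose (N + 1) : ℚ))
          #S := by
    intro S
    have hS : #S ≤ N := by simpa using S.card_le_univ
    simp only [prod_range_add_sub hS]
  have h3 := Finset.sum_powerset_apply_card (x := (Finset.univ : Finset (Fin N)))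
    (fun k => (-1 : ℚ) ^ k * ∏ i, ((N + 1).factorial * (x i + (N - k)).choose (N + 1) : ℚ))
  rw [Finset.powerset_univ, Finset.card_univ, Fintype.card_fin] at h3
  rw [Finset.sum_congr rfl fun S _ => h1 S, h3] at h
  have h2 : ((N + 1).factorial : ℚ) * ∑ α : Fin (s + 1) → Equiv.Perm (Fin (N + 1)) with
        (List.ofFn α).prod = finRotate (N + 1), ∏ i, (x i : ℚ) ^ cycleCount (α i) =
      (N + 1).factorial * ((N + 1).factorial ^ s * ∑ k ∈ range (N + 1), (N.choose k : ℚ) *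
          ((-1) ^ k * ∏ i, ((x i + (N - k)).choose (N + 1) : ℚ))) := by
    rw [h, ← mul_assoc, ← pow_succ', Finset.mul_sum]
    refine Finset.sum_congr rfl fun k _ => ?_
    rw [Finset.prod_mul_distrib, Finset.prod_const, Finset.card_univ, Fintype.card_fin,
      nsmul_eq_mul]
    ring
  exact_mod_cast mul_left_cancel₀ hfac h2
end
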